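/- arXiv:math/9409222 — 6 statements merged into one kernel-verified Lean document; each statement's English description precedes it below -/
import Mathlib

section
/- Let a, b, c, d, p be points in the Euclidean plane such that p lies in the open segment from a to b and also in the open segment from c to d, and such that the four points a, b, c, d are not all collinear. Then dist(a,c) + dist(b,d) < dist(a,b) + dist(c,d). -/
theorem exists_eq_smul_sub_add_of_mem_openSegment {E : Type*} [AddCommGroup E] [Module ℝ E]
    {a b p : E} (h : p ∈ openSegment ℝ a b) : ∃ s : ℝ, b = s • (a - p) + p := by
  obtain ⟨α, β, -, hβ, hαβ, rfl⟩ := h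
  refine ⟨-α / β, ?_⟩
  obtain rfl : α = 1 - β := by linarith
  match_scalars <;> field_simp <;> ring

/-- Quadrilateral exchange inequality: if `p` lies in the open segments `ab` and `cd`,
and `a, b, c, d` are not all collinear, then `dist a c + dist b d < dist a b + dist c d`. -/
theorem quad_exchange (a b c d p : EuclideanSpace ℝ (Fin 2))
    (hpab : p ∈ openSegment ℝ a b) (hpcd : p ∈ openSegment ℝ c d)
    (hncol : ¬ Collinear ℝ ({a, b, c, d} : Set (EuclideanSpace ℝ (Fin 2)))) :
    dist a c + dist b d < dist a b + dist c d := by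
  have hab := dist_add_dist_of_mem_segment (openSegment_subset_segment ℝ a b hpab)
  have hcd := dist_add_dist_of_mem_segment (openSegment_subset_segment ℝ c d hpcd)
  have hbd := dist_triangle b p d
  rw [dist_comm b p] at hbd
  have hac : dist a c < dist a p + dist p c := by
    refine (dist_triangle a p c).lt_of_ne fun h => hncol ?_
    have hcol : Collinear ℝ {a, p, c} := (dist_add_dist_eq_iff.1 h.symm).collinear
    rw [collinear_iff_of_mem (p₀ := p) (by simp)] at hcol
    obtain ⟨v, hv⟩ := hcol
    obtain ⟨x, hx⟩ := hv a (by simp)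
    obtain ⟨y, hy⟩ := hv c (by simp)
    obtain ⟨s, hs⟩ := exists_eq_smul_sub_add_of_mem_openSegment hpab
    obtain ⟨r, hr⟩ := exists_eq_smul_sub_add_of_mem_openSegment hpcd
    rw [vadd_eq_add] at hx hy
    rw [hx, add_sub_cancel_right, smul_smul] at hs
    rw [hy, add_sub_cancel_right, smul_smul] at hr
    refine (collinear_iff_exists_forall_eq_smul_vadd _).2 ⟨p, v, ?_⟩
    rintro q (rfl | rfl | rfl | rfl)
    exacts [⟨x, hx⟩, ⟨s * x, hs⟩, ⟨y, hy⟩, ⟨r * y, hr⟩]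
  rw [dist_comm p c] at hac
  linarith
end

section
/- Let P be a finite set of points in the Euclidean plane, no three of which are collinear, and let k ≤ |P|. Let S be a k-element subset of P and let T be a tree on S whose length is at most the length of every tree on every k-element subset of P (i.e., T is an optimal k-point spanning tree of P). Then T is non-self-intersecting: for any two edges {a,b} and {c,d} of T with a, b, c, d pairwise distinct, the open segment from a to b and the open segment from c to d are disjoint. -/
open scoped Classical

/-- The total Euclidean length of a graph on a finite set of points in the plane. -/
noncomputable def treeLength {S : Finset (EuclideanSpace ℝ (Fin 2))} (T : SimpleGraph S) : ℝ :=
  ∑ e ∈ T.edgeFinset,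
    Sym2.lift ⟨fun (a b : S) => dist (a : EuclideanSpace ℝ (Fin 2)) (b : EuclideanSpace ℝ (Fin 2)),
      fun a b => dist_comm _ _⟩ e

namespace SimpleGraph

variable {V : Type*} {G : SimpleGraph V}

/-- After deleting the edge `ab` of a connected graph, every vertex is reachable from `a` or
from `b`. -/
theorem Connected.reachable_deleteEdges_or (hG : G.Connected) (a b v : V) :
    (G.deleteEdges {s(a, b)}).Reachable v a ∨ (G.deleteEdges {s(a, b)}).Reachable v b := by
  suffices h : ∀ u, G.Walk v u → u = a →
      (G.deleteEdges {s(a, b)}).Reachable v a ∨ (G.deleteEdges {s(a, b)}).Reachable v b by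
    obtain ⟨p⟩ := hG v a
    exact h a p rfl
  intro u p hu
  induction p with
  | nil => exact Or.inl (hu ▸ Reachable.refl _)
  | @cons v w u h p ih =>
    by_cases he : s(v, w) = s(a, b)
    · rcases Sym2.eq_iff.1 he with ⟨rfl, -⟩ | ⟨rfl, -⟩
      · exact Or.inl (Reachable.refl _)
      · exact Or.inr (Reachable.refl _)
    · have hvw : (G.deleteEdges {s(a, b)}).Reachable v w :=
        Adj.reachable (by simpa [deleteEdges_adj] using And.intro h he)
      exact (ih hu).imp (fun h => hvw.trans h) (fun h => hvw.trans h)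

/-- The two ends of an edge of a forest are separated by the deletion of that edge. -/
theorem IsAcyclic.not_reachable_deleteEdges {a b : V} (hG : G.IsAcyclic) (hab : G.Adj a b) :
    ¬ (G.deleteEdges {s(a, b)}).Reachable a b :=
  isBridge_iff.1 (isAcyclic_iff_forall_adj_isBridge.1 hG hab)

/-- Edge exchange: in a tree, an edge `ab` can be replaced by any edge that joins the two
components left by its deletion. -/
theorem IsTree.deleteEdges_sup_edge {a b x y : V} (hG : G.IsTree) (hab : G.Adj a b)
    (hx : (G.deleteEdges {s(a, b)}).Reachable x a)
    (hy : (G.deleteEdges {s(a, b)}).Reachable y b) :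
    (G.deleteEdges {s(a, b)} ⊔ edge x y).IsTree := by
  have hxy : ¬ (G.deleteEdges {s(a, b)}).Reachable x y := fun h =>
    hG.isAcyclic.not_reachable_deleteEdges hab ((hx.symm.trans h).trans hy)
  have hne : x ≠ y := by
    rintro rfl
    exact hxy (Reachable.refl _)
  have hle : G.deleteEdges {s(a, b)} ≤ G.deleteEdges {s(a, b)} ⊔ edge x y := le_sup_left
  have hadj : (G.deleteEdges {s(a, b)} ⊔ edge x y).Reachable y x :=
    Adj.reachable (Or.inr (by simp [edge_adj, hne, hne.symm]))
  have key : ∀ v, (G.deleteEdges {s(a, b)} ⊔ edge x y).Reachable v x := fun v =>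
    (hG.connected.reachable_deleteEdges_or a b v).elim
      (fun h => (h.trans hx.symm).mono hle)
      (fun h => ((h.trans hy.symm).mono hle).trans hadj)
  have : Nonempty V := ⟨a⟩
  exact ⟨⟨fun u v => (key u).trans (key v).symm⟩,
    (hG.isAcyclic.anti (deleteEdges_le _)).sup_edge_of_not_reachable hxy⟩

end SimpleGraph

/-- Adding a new edge increases the length by the distance of its ends. -/
theorem treeLength_sup_edge {S : Finset (EuclideanSpace ℝ (Fin 2))} (G : SimpleGraph S) {x y : S}
    (hne : x ≠ y) (h : ¬ G.Adj x y) :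
    treeLength (G ⊔ SimpleGraph.edge x y) =
      dist (x : EuclideanSpace ℝ (Fin 2)) y + treeLength G := by
  unfold treeLength
  refine (Finset.sum_congr (s₂ := insert s(x, y) G.edgeFinset) ?_ fun _ _ => rfl).trans
    (Finset.sum_insert (by simpa using h))
  ext e
  simp [SimpleGraph.edgeSet_edge_of_ne hne, or_comm]

/-- In a shortest spanning tree, the edge `ab` is no longer than any edge that joins the two
components left by its deletion. -/
theorem dist_le_dist_of_shortest_tree {S : Finset (EuclideanSpace ℝ (Fin 2))} {T : SimpleGraph S}
    (hT : T.IsTree) (hopt : ∀ T' : SimpleGraph S, T'.IsTree → treeLength T ≤ treeLength T')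
    {a b x y : S} (hab : T.Adj a b)
    (hx : (T.deleteEdges {s(a, b)}).Reachable x a)
    (hy : (T.deleteEdges {s(a, b)}).Reachable y b) :
    dist (a : EuclideanSpace ℝ (Fin 2)) b ≤ dist (x : EuclideanSpace ℝ (Fin 2)) y := by
  have hxy : ¬ (T.deleteEdges {s(a, b)}).Reachable x y := fun h =>
    hT.isAcyclic.not_reachable_deleteEdges hab ((hx.symm.trans h).trans hy)
  have hne : x ≠ y := by
    rintro rfl
    exact hxy (SimpleGraph.Reachable.refl _)
  have hsup : T.deleteEdges {s(a, b)} ⊔ SimpleGraph.edge a b = T := by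
    ext u v
    simp only [SimpleGraph.sup_adj, SimpleGraph.deleteEdges_adj, SimpleGraph.edge_adj,
      Set.mem_singleton_iff, Sym2.eq_iff]
    constructor
    · rintro (⟨h, -⟩ | ⟨⟨rfl, rfl⟩ | ⟨rfl, rfl⟩, -⟩)
      exacts [h, hab, hab.symm]
    · intro h
      have := h.ne
      tauto
  have h1 := treeLength_sup_edge (T.deleteEdges {s(a, b)}) hab.ne (by simp)
  have h2 := treeLength_sup_edge (T.deleteEdges {s(a, b)}) hne (fun h => hxy h.reachable)
  have h3 := hopt _ (hT.deleteEdges_sup_edge hab hx hy)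
  rw [hsup] at h1
  linarith

/-- In a shortest spanning tree, for two distinct edges `ab` and `cd`, the edge `ab` is no longer
than the two segments that join one of its ends to `c` and `d`. -/
theorem dist_le_and_dist_le_or_of_shortest_tree {S : Finset (EuclideanSpace ℝ (Fin 2))}
    {T : SimpleGraph S} (hT : T.IsTree)
    (hopt : ∀ T' : SimpleGraph S, T'.IsTree → treeLength T ≤ treeLength T')
    {a b c d : S} (hab : T.Adj a b) (hcd : T.Adj c d) (hne : s(c, d) ≠ s(a, b)) :
    (dist (a : EuclideanSpace ℝ (Fin 2)) b ≤ dist (a : EuclideanSpace ℝ (Fin 2)) c ∧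
      dist (a : EuclideanSpace ℝ (Fin 2)) b ≤ dist (a : EuclideanSpace ℝ (Fin 2)) d) ∨
    (dist (a : EuclideanSpace ℝ (Fin 2)) b ≤ dist (c : EuclideanSpace ℝ (Fin 2)) b ∧
      dist (a : EuclideanSpace ℝ (Fin 2)) b ≤ dist (d : EuclideanSpace ℝ (Fin 2)) b) := by
  have hr : (T.deleteEdges {s(a, b)}).Reachable d c :=
    SimpleGraph.Adj.reachable ((SimpleGraph.deleteEdges_adj.2 ⟨hcd, hne⟩).symm)
  have ha := SimpleGraph.Reachable.refl (G := T.deleteEdges {s(a, b)}) a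
  have hb := SimpleGraph.Reachable.refl (G := T.deleteEdges {s(a, b)}) b
  rcases hT.connected.reachable_deleteEdges_or a b c with h | h
  · exact Or.inr ⟨dist_le_dist_of_shortest_tree hT hopt hab h hb,
      dist_le_dist_of_shortest_tree hT hopt hab (hr.trans h) hb⟩
  · exact Or.inl ⟨dist_le_dist_of_shortest_tree hT hopt hab ha h,
      dist_le_dist_of_shortest_tree hT hopt hab ha (hr.trans h)⟩

/-- If the segments `ab` and `cd` cross and `a`, `b`, `c` are not collinear, then the opposite
sides `ac`, `bd` of the quadrilateral are together shorter than its diagonals. -/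
theorem dist_add_dist_lt_of_mem_openSegment {E : Type*} [NormedAddCommGroup E] [NormedSpace ℝ E]
    [StrictConvexSpace ℝ E] {a b c d p : E}
    (h : ¬ Collinear ℝ ({a, b, c} : Set E))
    (hab : p ∈ openSegment ℝ a b) (hcd : p ∈ openSegment ℝ c d) :
    dist a c + dist b d < dist a b + dist c d := by
  have hne : a ≠ b := by
    rintro rfl
    exact h (by simpa using collinear_pair ℝ a c)
  have hs := sbtw_iff_mem_image_Ioo_and_ne.2 ⟨by rwa [openSegment_eq_image_lineMap] at hab, hne⟩
  have h1 := dist_add_dist_of_mem_segment (openSegment_subset_segment ℝ _ _ hab)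
  have h2 := dist_add_dist_of_mem_segment (openSegment_subset_segment ℝ _ _ hcd)
  have h3 : dist a c < dist a p + dist p c := by
    rw [dist_lt_dist_add_dist_iff]
    intro hw
    refine h ((collinear_insert_insert_of_mem_affineSpan_pair (p₁ := b) (p₂ := c) (p₃ := a)
      (p₄ := p) ?_ ?_).subset ?_)
    · exact hs.right_mem_affineSpan
    · exact hw.right_mem_affineSpan_of_left_ne hs.left_ne
    · intro z
      simp only [Set.mem_insert_iff, Set.mem_singleton_iff]
      tauto
  have h4 := dist_triangle b p d
  rw [dist_comm c p] at h2
  rw [dist_comm p b] at h1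
  linarith

/-- Lemma 5.1: an optimal `k`-point spanning tree of a planar point set with no three
points collinear is non-self-intersecting. -/
theorem optimal_kMST_non_self_intersecting (P : Finset (EuclideanSpace ℝ (Fin 2)))
    (hP : ∀ a ∈ P, ∀ b ∈ P, ∀ c ∈ P, a ≠ b → a ≠ c → b ≠ c →
      ¬ Collinear ℝ ({a, b, c} : Set (EuclideanSpace ℝ (Fin 2))))
    (k : ℕ) (hk : k ≤ P.card)
    (S : Finset (EuclideanSpace ℝ (Fin 2))) (hSP : S ⊆ P) (hScard : S.card = k)
    (T : SimpleGraph S) (hT : T.IsTree)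
    (hopt : ∀ S' : Finset (EuclideanSpace ℝ (Fin 2)), S' ⊆ P → S'.card = k →
      ∀ T' : SimpleGraph S', T'.IsTree → treeLength T ≤ treeLength T') :
    ∀ a b c d : S, T.Adj a b → T.Adj c d →
      (a : EuclideanSpace ℝ (Fin 2)) ≠ b → (a : EuclideanSpace ℝ (Fin 2)) ≠ c →
      (a : EuclideanSpace ℝ (Fin 2)) ≠ d → (b : EuclideanSpace ℝ (Fin 2)) ≠ c →
      (b : EuclideanSpace ℝ (Fin 2)) ≠ d → (c : EuclideanSpace ℝ (Fin 2)) ≠ d →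
      Disjoint (openSegment ℝ (a : EuclideanSpace ℝ (Fin 2)) (b : EuclideanSpace ℝ (Fin 2)))
        (openSegment ℝ (c : EuclideanSpace ℝ (Fin 2)) (d : EuclideanSpace ℝ (Fin 2))) := by
  have hopt' : ∀ T' : SimpleGraph S, T'.IsTree → treeLength T ≤ treeLength T' := hopt S hSP hScard
  intro a b c d hab hcd nab nac nad nbc nbd ncd
  rw [Set.disjoint_left]
  intro p hp hp'
  have hne : s(c, d) ≠ s(a, b) := by
    intro h
    rcases Sym2.eq_iff.1 h with ⟨h, -⟩ | ⟨h, -⟩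
    · exact nac (congrArg _ h.symm)
    · exact nbc (congrArg _ h.symm)
  have h1 := dist_add_dist_lt_of_mem_openSegment
    (hP a (hSP a.2) b (hSP b.2) c (hSP c.2) nab nac nbc) hp hp'
  have h2 := dist_add_dist_lt_of_mem_openSegment
    (hP a (hSP a.2) b (hSP b.2) d (hSP d.2) nab nad nbd) hp
    (openSegment_symm ℝ (c : EuclideanSpace ℝ (Fin 2)) d ▸ hp')
  have h3 := dist_le_and_dist_le_or_of_shortest_tree hT hopt' hab hcd hne
  have h4 := dist_le_and_dist_le_or_of_shortest_tree hT hopt' hcd hab hne.symm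
  simp only [dist_comm (d : EuclideanSpace ℝ (Fin 2)), dist_comm (c : EuclideanSpace ℝ (Fin 2)) a,
    dist_comm (c : EuclideanSpace ℝ (Fin 2)) b] at h1 h2 h3 h4
  rcases h3 with ⟨h3, h3'⟩ | ⟨h3, h3'⟩ <;> rcases h4 with ⟨h4, h4'⟩ | ⟨h4, h4'⟩ <;> linarith
end

section
/- Let S be a set of points in the Euclidean plane and let a, b ∈ S be such that dist(p,q) ≤ dist(a,b) for all p, q ∈ S (so dist(a,b) equals the diameter Δ of S). Then every point p of S satisfies dist(p, midpoint(a,b)) ≤ (√3/2)·dist(a,b); that is, S is contained in the closed disc of diameter √3·Δ centered at the midpoint of the segment from a to b. -/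
/-- Lemma 4.1: if `dist a b` realizes the diameter of `S`, then `S` is contained in the
closed disc of diameter `√3 · dist a b` centered at the midpoint of `a` and `b`. -/
theorem subset_disc_of_diameter (S : Set (EuclideanSpace ℝ (Fin 2)))
    (a b : EuclideanSpace ℝ (Fin 2)) (ha : a ∈ S) (hb : b ∈ S)
    (hdiam : ∀ p ∈ S, ∀ q ∈ S, dist p q ≤ dist a b) :
    ∀ p ∈ S, dist p (midpoint ℝ a b) ≤ (Real.sqrt 3 / 2) * dist a b := by
  intro p hp
  have apollonius :=
    EuclideanGeometry.dist_sq_add_dist_sq_eq_two_mul_dist_midpoint_sq_add_half_dist_sq p a b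
  have hpa : dist p a ^ 2 ≤ dist a b ^ 2 := by gcongr; exact hdiam p hp a ha
  have hpb : dist p b ^ 2 ≤ dist a b ^ 2 := by gcongr; exact hdiam p hp b hb
  refine (sq_le_sq₀ (by positivity) (by positivity)).mp ?_
  rw [mul_pow, div_pow, Real.sq_sqrt (by norm_num)]
  linarith
end

section
/- Let σ > 0 and let x : Fin t → EuclideanSpace ℝ (Fin 2) be points such that the map sending i to the grid cell (⌊(x i) 0 / σ⌋, ⌊(x i) 1 / σ⌋) is injective (i.e., the t points lie in distinct cells of a square grid with cell side σ). Then there exists a subset s of Fin t with 9·|s| ≥ t such that dist(x i, x j) ≥ σ for all distinct i, j ∈ s. -/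
theorem Fintype.exists_card_le_card_mul_card_fiber {α β : Type*} [Fintype α] [Fintype β]
    [DecidableEq β] [Nonempty β] (f : α → β) :
    ∃ b, Fintype.card α ≤ Fintype.card β * (Finset.univ.filter fun a => f a = b).card := by
  have hβ : (Fintype.card β : ℚ) ≠ 0 := by exact_mod_cast Fintype.card_ne_zero
  obtain ⟨b, hb⟩ := Fintype.exists_le_card_fiber_of_nsmul_le_card f
    (b := (Fintype.card α / Fintype.card β : ℚ)) (by rw [nsmul_eq_mul, mul_div_cancel₀ _ hβ])
  refine ⟨b, ?_⟩
  rw [div_le_iff₀' (by positivity)] at hb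
  exact_mod_cast hb

theorem le_abs_sub_of_add_two_le_floor_div {σ a b : ℝ} (hσ : 0 < σ)
    (h : ⌊a / σ⌋ + 2 ≤ ⌊b / σ⌋) : σ ≤ |a - b| := by
  have ha := Int.lt_floor_add_one (a / σ)
  have hb := Int.floor_le (b / σ)
  have h' : (⌊a / σ⌋ : ℝ) + 2 ≤ ⌊b / σ⌋ := by exact_mod_cast h
  have hab : 1 ≤ (b - a) / σ := by rw [sub_div]; linarith
  rw [one_le_div hσ] at hab
  exact hab.trans (abs_sub_comm a b ▸ le_abs_self _)

theorem le_abs_sub_of_floor_div_modEq {σ a b : ℝ} {n : ℕ} (hn : 2 ≤ n) (hσ : 0 < σ)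
    (hmod : (⌊a / σ⌋ : ZMod n) = ⌊b / σ⌋) (hne : ⌊a / σ⌋ ≠ ⌊b / σ⌋) : σ ≤ |a - b| := by
  wlog hlt : ⌊a / σ⌋ < ⌊b / σ⌋ generalizing a b
  · rw [abs_sub_comm]
    exact this hmod.symm hne.symm (hne.lt_or_gt.resolve_left hlt)
  have hdvd := (ZMod.intCast_eq_intCast_iff_dvd_sub _ _ _).1 hmod
  have := Int.le_of_dvd (sub_pos.2 hlt) hdvd
  exact le_abs_sub_of_add_two_le_floor_div hσ (by omega)

theorem EuclideanSpace.abs_sub_apply_le_dist {ι : Type*} [Fintype ι] (x y : EuclideanSpace ℝ ι)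
    (k : ι) : |x k - y k| ≤ dist x y := by
  rw [dist_eq_norm]
  exact PiLp.norm_apply_le (x - y) k


/-- From `t` points lying in distinct cells of a square grid with cell side `σ`, one can
choose at least `t / 9` points that are pairwise at distance at least `σ`. -/
theorem exists_spread_subset_of_distinct_cells (σ : ℝ) (hσ : 0 < σ) (t : ℕ)
    (x : Fin t → EuclideanSpace ℝ (Fin 2))
    (hinj : Function.Injective fun i => ((⌊x i 0 / σ⌋ : ℤ), (⌊x i 1 / σ⌋ : ℤ))) :
    ∃ s : Finset (Fin t), t ≤ 9 * s.card ∧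
      ∀ i ∈ s, ∀ j ∈ s, i ≠ j → σ ≤ dist (x i) (x j) := by
  obtain ⟨c, hc⟩ := Fintype.exists_card_le_card_mul_card_fiber
    fun i => ((⌊x i 0 / σ⌋ : ZMod 3), (⌊x i 1 / σ⌋ : ZMod 3))
  refine ⟨_, by simpa [ZMod.card] using hc, fun i hi j hj hij => ?_⟩
  have hcol := (Finset.mem_filter.1 hi).2.trans (Finset.mem_filter.1 hj).2.symm
  obtain ⟨h0, h1⟩ := Prod.mk.inj hcol
  by_cases hne : ⌊x i 0 / σ⌋ = ⌊x j 0 / σ⌋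
  · have hne' : ⌊x i 1 / σ⌋ ≠ ⌊x j 1 / σ⌋ := fun h => hij (hinj (Prod.ext hne h))
    exact (le_abs_sub_of_floor_div_modEq (by norm_num) hσ h1 hne').trans
      (EuclideanSpace.abs_sub_apply_le_dist _ _ 1)
  · exact (le_abs_sub_of_floor_div_modEq (by norm_num) hσ h0 hne).trans
      (EuclideanSpace.abs_sub_apply_le_dist _ _ 0)
end

section
/- Let σ > 0 and let t be a natural number. Let x : Fin t → EuclideanSpace ℝ (Fin 2) be points such that the map sending i to the grid cell (⌊(x i) 0 / σ⌋, ⌊(x i) 1 / σ⌋) is injective. Then for every simple graph T on Fin t that is a tree (connected and acyclic), writing L for the sum over the edges {i,j} of T of dist(x i, x j), we have (⌈t/9⌉ - 1)·σ ≤ 2·L. -/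
/-- Along a walk, a function increases by at most the sum of the edge weights that bound its
increments. -/
theorem SimpleGraph.Walk.sub_le_sum_edges {V : Type*} {G : SimpleGraph V} {f : V → ℝ}
    {g : Sym2 V → ℝ} (h : ∀ i j, G.Adj i j → f j - f i ≤ g s(i, j)) {a b : V} (p : G.Walk a b) :
    f b - f a ≤ (p.edges.map g).sum := by
  induction p with
  | nil => simp
  | cons hadj p ih =>
    simp only [SimpleGraph.Walk.edges_cons, List.map_cons, List.sum_cons]
    linarith [h _ _ hadj]

/-- On a connected graph, a function varies by at most the total weight of the edges, if the edge
weights bound its increments. -/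
theorem SimpleGraph.Connected.sub_le_sum_edgeFinset {V : Type*} {G : SimpleGraph V}
    [Fintype G.edgeSet] (hG : G.Connected) {f : V → ℝ} {g : Sym2 V → ℝ} (hg : ∀ e, 0 ≤ g e)
    (h : ∀ i j, G.Adj i j → f j - f i ≤ g s(i, j)) (a b : V) :
    f b - f a ≤ ∑ e ∈ G.edgeFinset, g e := by
  classical
  obtain ⟨p, hp⟩ := (hG a b).exists_isPath
  refine (p.sub_le_sum_edges h).trans ?_
  rw [← List.sum_toFinset g hp.isTrail.edges_nodup]
  refine Finset.sum_le_sum_of_subset_of_nonneg (fun e he => ?_) fun e _ _ => hg e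
  rw [SimpleGraph.mem_edgeFinset]
  exact p.edges_subset_edgeSet (List.mem_toFinset.1 he)

/-- Truncated distances to the points of a `2r`-separated set vary in total by at most twice the
distance. -/
theorem sum_abs_min_dist_sub_min_dist_le {V X : Type*} [PseudoMetricSpace X] (x : V → X)
    {S : Finset V} {r : ℝ} (hS : ∀ a ∈ S, ∀ b ∈ S, a ≠ b → 2 * r ≤ dist (x a) (x b)) (y z : X) :
    ∑ s ∈ S, |min r (dist (x s) y) - min r (dist (x s) z)| ≤ 2 * dist y z := by
  classical
  have hcard (y : X) : ((S.filter fun s => dist (x s) y < r).card : ℝ) ≤ 1 := by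
    refine Nat.cast_le_one.2 (Finset.card_le_one.2 fun a ha b hb => ?_)
    rw [Finset.mem_filter] at ha hb
    by_contra hab
    linarith [hS a ha.1 b hb.1 hab, dist_triangle_right (x a) (x b) y, ha.2, hb.2]
  calc ∑ s ∈ S, |min r (dist (x s) y) - min r (dist (x s) z)|
      ≤ ∑ s ∈ S, ((if dist (x s) y < r then dist y z else 0) +
          if dist (x s) z < r then dist y z else 0) := by
        refine Finset.sum_le_sum fun s _ => ?_
        have h1 := dist_triangle (x s) y z
        have h2 := dist_triangle_right (x s) y z
        have h3 : 0 ≤ dist y z := dist_nonneg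
        rw [abs_le]
        split_ifs <;> grind
    _ = ((S.filter fun s => dist (x s) y < r).card +
          (S.filter fun s => dist (x s) z < r).card) * dist y z := by
        rw [Finset.sum_add_distrib, ← Finset.sum_filter, ← Finset.sum_filter]
        simp [add_mul]
    _ ≤ 2 * dist y z := by
        have := hcard y
        have := hcard z
        gcongr
        linarith

/-- A connected graph whose vertices include a `2r`-separated set `S` with at least two elements
has total length at least `#S * r / 2`. -/
theorem card_mul_le_two_mul_sum_dist_of_connected {V X : Type*} [PseudoMetricSpace X]
    {G : SimpleGraph V} [Fintype G.edgeSet] (hG : G.Connected) (x : V → X) {S : Finset V} {r : ℝ}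
    (hr : 0 ≤ r) (hS : ∀ a ∈ S, ∀ b ∈ S, a ≠ b → 2 * r ≤ dist (x a) (x b))
    (hcard : 1 < S.card) :
    S.card * r ≤ 2 * ∑ e ∈ G.edgeFinset,
      Sym2.lift ⟨fun i j => dist (x i) (x j), fun i j => dist_comm (x i) (x j)⟩ e := by
  let g (s : V) : Sym2 V → ℝ :=
    Sym2.lift ⟨fun i j => |min r (dist (x s) (x i)) - min r (dist (x s) (x j))|,
      fun _ _ => abs_sub_comm _ _⟩
  have hg (s : V) (hs : s ∈ S) : r ≤ ∑ e ∈ G.edgeFinset, g s e := by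
    obtain ⟨b, hb, hbs⟩ := Finset.exists_mem_ne hcard s
    have h := hG.sub_le_sum_edgeFinset (f := fun i => min r (dist (x s) (x i))) (g := g s)
      (fun e => e.ind fun _ _ => abs_nonneg _)
      (fun i j _ => (le_abs_self _).trans_eq (abs_sub_comm _ _)) s b
    have hsb : r ≤ dist (x s) (x b) := by linarith [hS s hs b hb hbs.symm]
    simpa [min_eq_left hsb, min_eq_right hr] using h
  calc (S.card : ℝ) * r = ∑ s ∈ S, r := by simp
    _ ≤ ∑ s ∈ S, ∑ e ∈ G.edgeFinset, g s e := Finset.sum_le_sum hg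
    _ = ∑ e ∈ G.edgeFinset, ∑ s ∈ S, g s e := Finset.sum_comm
    _ ≤ _ := by
      rw [Finset.mul_sum]
      refine Finset.sum_le_sum fun e _ => ?_
      induction e with
      | _ i j => exact sum_abs_min_dist_sub_min_dist_le x hS (x i) (x j)

/-- Two reals that lie in distinct cells of the grid of mesh `σ`, with cell indices congruent mod 3,
are at least `2σ` apart. -/
theorem two_mul_le_abs_sub_of_floor_div {σ u v : ℝ} (hσ : 0 < σ) (hne : ⌊u / σ⌋ ≠ ⌊v / σ⌋)
    (hmod : ((⌊u / σ⌋ : ℤ) : ZMod 3) = (⌊v / σ⌋ : ℤ)) : 2 * σ ≤ |u - v| := by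
  rw [ZMod.intCast_eq_intCast_iff_dvd_sub] at hmod
  have hu := Int.floor_le (u / σ)
  have hv := Int.floor_le (v / σ)
  have hu' := Int.lt_floor_add_one (u / σ)
  have hv' := Int.lt_floor_add_one (v / σ)
  have h : 2 ≤ |u / σ - v / σ| := by
    rw [le_abs]
    rcases (by push_cast at hmod; omega :
      ⌊v / σ⌋ + 3 ≤ ⌊u / σ⌋ ∨ ⌊u / σ⌋ + 3 ≤ ⌊v / σ⌋) with h | h
    · have : (⌊v / σ⌋ : ℝ) + 3 ≤ ⌊u / σ⌋ := by exact_mod_cast h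
      left; linarith
    · have : (⌊u / σ⌋ : ℝ) + 3 ≤ ⌊v / σ⌋ := by exact_mod_cast h
      right; linarith
  rwa [← sub_div, abs_div, abs_of_pos hσ, le_div_iff₀ hσ] at h

open scoped Classical in
/-- Lemma 4.2: the length `L` of a spanning tree of `t` points lying in distinct cells of
a square grid with cell side `σ` satisfies `(⌈t/9⌉ - 1) · σ ≤ 2 · L`. -/
theorem tree_length_lower_bound_of_distinct_cells (σ : ℝ) (hσ : 0 < σ) (t : ℕ)
    (x : Fin t → EuclideanSpace ℝ (Fin 2))
    (hinj : Function.Injective fun i => ((⌊x i 0 / σ⌋ : ℤ), (⌊x i 1 / σ⌋ : ℤ)))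
    (T : SimpleGraph (Fin t)) (hT : T.IsTree) :
    ((⌈(t : ℝ) / 9⌉ : ℝ) - 1) * σ ≤
      2 * ∑ e ∈ T.edgeFinset,
        Sym2.lift ⟨fun i j => dist (x i) (x j), fun i j => dist_comm (x i) (x j)⟩ e := by
  let c (i : Fin t) : ZMod 3 × ZMod 3 := ((⌊x i 0 / σ⌋ : ℤ), (⌊x i 1 / σ⌋ : ℤ))
  obtain ⟨y, hy⟩ := Fintype.exists_le_card_fiber_of_nsmul_le_card c (b := (t : ℝ) / 9)
    (by simp [ZMod.card]; linarith)
  set S := Finset.univ.filter fun i => c i = y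
  have hceil : (⌈(t : ℝ) / 9⌉ : ℝ) ≤ S.card := by
    exact_mod_cast Int.ceil_le.2 (by exact_mod_cast hy)
  have hS : ∀ a ∈ S, ∀ b ∈ S, a ≠ b → 2 * σ ≤ dist (x a) (x b) := by
    intro a ha b hb hab
    have hc : c a = c b := by
      rw [(Finset.mem_filter.1 ha).2, (Finset.mem_filter.1 hb).2]
    have hcoord (k : Fin 2) : |x a k - x b k| ≤ dist (x a) (x b) := by
      rw [dist_eq_norm]
      exact PiLp.norm_apply_le (x a - x b) k
    by_cases h0 : ⌊x a 0 / σ⌋ = ⌊x b 0 / σ⌋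
    · have h1 : ⌊x a 1 / σ⌋ ≠ ⌊x b 1 / σ⌋ := fun h1 => hab (hinj (Prod.ext h0 h1))
      exact (two_mul_le_abs_sub_of_floor_div hσ h1 (congrArg Prod.snd hc)).trans (hcoord 1)
    · exact (two_mul_le_abs_sub_of_floor_div hσ h0 (congrArg Prod.fst hc)).trans (hcoord 0)
  rcases lt_or_ge 1 S.card with hcard | hcard
  · refine le_trans ?_ (card_mul_le_two_mul_sum_dist_of_connected hT.connected x hσ.le hS hcard)
    gcongr
    linarith
  · have hcard' : (S.card : ℝ) ≤ 1 := by exact_mod_cast hcard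
    refine (mul_nonpos_of_nonpos_of_nonneg (by linarith) hσ.le).trans ?_
    refine mul_nonneg zero_le_two (Finset.sum_nonneg fun e _ => ?_)
    induction e with
    | _ i j => exact dist_nonneg (x := x i) (y := x j)
end

section
/- There exists a constant C > 0 such that for every σ > 0, every natural number q ≥ 1, and every family x : Fin q → EuclideanSpace ℝ (Fin 2) of points all of whose coordinates lie in the interval [0, σ] (i.e., all q points lie in an axis-parallel square of side σ), there exists a connected simple graph T on Fin q such that the sum over the edges {i,j} of T of dist(x i, x j) is at most C·σ·√q. -/
/-- The length of the edge `s(i, j)` when the vertices are placed at the points `x i`. -/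
def edgeLength {ι E : Type*} [PseudoMetricSpace E] (x : ι → E) : Sym2 ι → ℝ :=
  Sym2.lift ⟨fun i j => dist (x i) (x j), fun i j => dist_comm (x i) (x j)⟩

theorem edgeLength_mk {ι E : Type*} [PseudoMetricSpace E] (x : ι → E) (i j : ι) :
    edgeLength x s(i, j) = dist (x i) (x j) := rfl

theorem edgeLength_nonneg {ι E : Type*} [PseudoMetricSpace E] (x : ι → E) (e : Sym2 ι) :
    0 ≤ edgeLength x e := by
  induction e using Sym2.ind with
  | _ i j => exact dist_nonneg

theorem exists_nat_lt_unit_interval {m : ℕ} (hm : 1 ≤ m) {t : ℝ} (h0 : 0 ≤ t) (h1 : t ≤ m) :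
    ∃ k < m, (k : ℝ) ≤ t ∧ t ≤ k + 1 := by
  rcases h1.lt_or_eq with h | h
  · exact ⟨⌊t⌋₊, (Nat.floor_lt h0).2 h, Nat.floor_le h0, (Nat.lt_floor_add_one t).le⟩
  · refine ⟨m - 1, by omega, ?_, ?_⟩ <;> rw [Nat.cast_sub hm] <;> push_cast <;> linarith

/-- More than `m²` points in a square of side `σ` contain two that share a cell of the
`m × m` grid. -/
theorem exists_ne_dist_le_of_sq_lt_card {ι : Type*} {σ : ℝ} (hσ : 0 < σ)
    {x : ι → EuclideanSpace ℝ (Fin 2)} (hx : ∀ i j, x i j ∈ Set.Icc (0 : ℝ) σ)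
    {m : ℕ} (hm : 1 ≤ m) {S : Finset ι} (hS : m ^ 2 < S.card) :
    ∃ a ∈ S, ∃ b ∈ S, a ≠ b ∧ dist (x a) (x b) ≤ 3 / 2 * (σ / m) := by
  have hm0 : (0 : ℝ) < m := by exact_mod_cast hm
  have key (i : ι) (j : Fin 2) : ∃ k < m, (k : ℝ) ≤ x i j * m / σ ∧ x i j * m / σ ≤ k + 1 := by
    refine exists_nat_lt_unit_interval hm ?_ ?_
    · have := (hx i j).1
      positivity
    · rw [div_le_iff₀ hσ, mul_comm]
      exact mul_le_mul_of_nonneg_left (hx i j).2 hm0.le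
  choose k hkm hk1 hk2 using key
  obtain ⟨a, ha, b, hb, hab, h⟩ := Finset.exists_ne_map_eq_of_card_lt_of_maps_to
    (s := S) (t := Finset.range m ×ˢ Finset.range m) (f := fun i => (k i 0, k i 1))
    (by simpa [← sq] using hS) (fun i _ => by simp [hkm])
  refine ⟨a, ha, b, hb, hab, ?_⟩
  have hk (j : Fin 2) : k a j = k b j := by
    rw [Prod.mk.injEq] at h
    fin_cases j
    exacts [h.1, h.2]
  have hcoord (j : Fin 2) : (x a j - x b j) ^ 2 ≤ (σ / m) ^ 2 := by
    have h1 := hk1 a j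
    have h2 := hk2 a j
    have h3 := hk1 b j
    have h4 := hk2 b j
    rw [hk j] at h1 h2
    have hfac : x a j - x b j = (x a j * m / σ - x b j * m / σ) * (σ / m) := by field_simp
    rw [hfac, mul_pow]
    refine mul_le_of_le_one_left (sq_nonneg _) ?_
    rw [sq_le_one_iff_abs_le_one, abs_le]
    constructor <;> linarith
  rw [EuclideanSpace.dist_eq, Fin.sum_univ_two, Real.dist_eq, Real.dist_eq, sq_abs, sq_abs]
  refine Real.sqrt_le_iff.2 ⟨by positivity, ?_⟩
  nlinarith [hcoord 0, hcoord 1, sq_nonneg (σ / m)]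

theorem exists_ne_dist_le_div_sqrt_card {ι : Type*} {σ : ℝ} (hσ : 0 < σ)
    {x : ι → EuclideanSpace ℝ (Fin 2)} (hx : ∀ i j, x i j ∈ Set.Icc (0 : ℝ) σ)
    {S : Finset ι} (hS : 1 < S.card) :
    ∃ a ∈ S, ∃ b ∈ S, a ≠ b ∧ dist (x a) (x b) ≤ 3 * σ / √(S.card) := by
  have hm : 1 ≤ Nat.sqrt (S.card - 1) := Nat.le_sqrt.2 (by omega)
  have hle := Nat.sqrt_le' (S.card - 1)
  have hlt := Nat.lt_succ_sqrt' (S.card - 1)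
  generalize Nat.sqrt (S.card - 1) = m at hm hle hlt
  obtain ⟨a, ha, b, hb, hab, h⟩ := exists_ne_dist_le_of_sq_lt_card hσ hx hm (S := S) (by omega)
  refine ⟨a, ha, b, hb, hab, h.trans ?_⟩
  have hm0 : (0 : ℝ) < m := by exact_mod_cast hm
  have hcard : S.card ≤ (2 * m) ^ 2 :=
    (show S.card ≤ m.succ ^ 2 by omega).trans (Nat.pow_le_pow_left (by omega) 2)
  have hsqrt : √(S.card) ≤ 2 * m := Real.sqrt_le_iff.2 ⟨by positivity, by exact_mod_cast hcard⟩
  have hpos : 0 < √(S.card : ℝ) := Real.sqrt_pos.2 (by exact_mod_cast (by omega : 0 < S.card))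
  calc 3 / 2 * (σ / m) = 3 * σ / (2 * m) := by field_simp
    _ ≤ 3 * σ / √(S.card) := by gcongr

theorem two_mul_sqrt_add_inv_sqrt_succ_le (n : ℕ) :
    2 * √(n : ℝ) + 1 / √((n + 1 : ℕ) : ℝ) ≤ 2 * √((n + 1 : ℕ) : ℝ) := by
  have hpos : 0 < √((n + 1 : ℕ) : ℝ) := Real.sqrt_pos.2 (by positivity)
  have h1 := Real.sq_sqrt (Nat.cast_nonneg (α := ℝ) n)
  have h2 := Real.sq_sqrt (Nat.cast_nonneg (α := ℝ) (n + 1))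
  rw [← le_sub_iff_add_le', div_le_iff₀ hpos]
  push_cast at *
  nlinarith [sq_nonneg (√((n : ℝ) + 1) - √(n : ℝ))]

open scoped Classical in
/-- Any finite set of points in a square of side `σ` is connected by a set of edges of total
length at most `6 σ √n`, built by repeatedly detaching one of two close points. -/
theorem exists_edges_reachable_sum_edgeLength_le {ι : Type*} {σ : ℝ} (hσ : 0 < σ)
    {x : ι → EuclideanSpace ℝ (Fin 2)} (hx : ∀ i j, x i j ∈ Set.Icc (0 : ℝ) σ)
    (S : Finset ι) :
    ∃ E : Finset (Sym2 ι),
      (∀ a ∈ S, ∀ b ∈ S, (SimpleGraph.fromEdgeSet (E : Set (Sym2 ι))).Reachable a b) ∧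
      ∑ e ∈ E, edgeLength x e ≤ 6 * σ * √(S.card) := by
  induction hn : S.card generalizing S with
  | zero =>
    rw [Finset.card_eq_zero] at hn
    subst hn
    exact ⟨∅, by simp, by simp⟩
  | succ n ih =>
    rcases Nat.eq_zero_or_pos n with rfl | hpos
    · refine ⟨∅, fun a ha b hb => ?_, ?_⟩
      · rw [Finset.card_le_one.1 hn.le a ha b hb]
      · rw [Finset.sum_empty]
        positivity
    obtain ⟨a, ha, b, hb, hab, hd⟩ :=
      exists_ne_dist_le_div_sqrt_card hσ hx (S := S) (by omega)
    obtain ⟨E, hE, hsum⟩ := ih (S.erase a) (by rw [Finset.card_erase_of_mem ha, hn]; rfl)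
    have hmono : SimpleGraph.fromEdgeSet (E : Set (Sym2 ι)) ≤
        SimpleGraph.fromEdgeSet (insert s(a, b) E : Finset (Sym2 ι)) :=
      SimpleGraph.fromEdgeSet_mono (by simp)
    refine ⟨insert s(a, b) E, ?_, ?_⟩
    · have hab' : (SimpleGraph.fromEdgeSet
          ((insert s(a, b) E : Finset (Sym2 ι)) : Set (Sym2 ι))).Reachable a b :=
        SimpleGraph.Adj.reachable (by simp [hab])
      have hto (c : ι) (hc : c ∈ S) : (SimpleGraph.fromEdgeSet
          ((insert s(a, b) E : Finset (Sym2 ι)) : Set (Sym2 ι))).Reachable c b := by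
        by_cases hca : c = a
        · rwa [hca]
        · exact (hE c (Finset.mem_erase.2 ⟨hca, hc⟩) b
            (Finset.mem_erase.2 ⟨hab.symm, hb⟩)).mono hmono
      exact fun c hc d hd => (hto c hc).trans (hto d hd).symm
    · have hins : ∑ e ∈ insert s(a, b) E, edgeLength x e ≤
          edgeLength x s(a, b) + ∑ e ∈ E, edgeLength x e := by
        by_cases hmem : s(a, b) ∈ E
        · rw [Finset.insert_eq_of_mem hmem]
          exact le_add_of_nonneg_left (edgeLength_nonneg x _)
        · rw [Finset.sum_insert hmem]
      rw [hn] at hd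
      calc ∑ e ∈ insert s(a, b) E, edgeLength x e
          ≤ 3 * σ / √((n + 1 : ℕ) : ℝ) + 6 * σ * √(n : ℝ) := hins.trans (add_le_add hd hsum)
        _ = 3 * σ * (2 * √(n : ℝ) + 1 / √((n + 1 : ℕ) : ℝ)) := by ring
        _ ≤ 3 * σ * (2 * √((n + 1 : ℕ) : ℝ)) := by
          gcongr
          exact two_mul_sqrt_add_inv_sqrt_succ_le n
        _ = 6 * σ * √((n + 1 : ℕ) : ℝ) := by ring


open scoped Classical in
/-- Lemma 4.4: there is a constant `C` such that any `q` points in an axis-parallel square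
of side `σ` can be connected by a graph of total edge length at most `C · σ · √q`. -/
theorem exists_short_connected_graph_in_square :
    ∃ C : ℝ, 0 < C ∧ ∀ (σ : ℝ), 0 < σ → ∀ (q : ℕ), 1 ≤ q →
      ∀ x : Fin q → EuclideanSpace ℝ (Fin 2),
        (∀ i : Fin q, ∀ j : Fin 2, x i j ∈ Set.Icc (0 : ℝ) σ) →
        ∃ T : SimpleGraph (Fin q), T.Connected ∧
          ∑ e ∈ T.edgeFinset,
              Sym2.lift ⟨fun i j => dist (x i) (x j), fun i j => dist_comm (x i) (x j)⟩ e ≤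
            C * σ * Real.sqrt q := by
  refine ⟨6, by norm_num, fun σ hσ q hq x hx => ?_⟩
  obtain ⟨E, hE, hsum⟩ := exists_edges_reachable_sum_edgeLength_le hσ hx Finset.univ
  rw [Finset.card_univ, Fintype.card_fin] at hsum
  have : Nonempty (Fin q) := ⟨⟨0, hq⟩⟩
  refine ⟨SimpleGraph.fromEdgeSet (E : Set (Sym2 (Fin q))),
    ⟨fun a b => hE a (Finset.mem_univ a) b (Finset.mem_univ b)⟩, le_trans ?_ hsum⟩
  refine Finset.sum_le_sum_of_subset_of_nonneg (fun e he => ?_)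
    fun e _ _ => edgeLength_nonneg x e
  have hmem := (@Set.mem_toFinset _ _ (_) _).1 he
  rw [SimpleGraph.edgeSet_fromEdgeSet] at hmem
  exact hmem.1
end
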